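/- Let K ≥ 1 be an integer and set m = 2K − 1. Let f : [0,1] → ℝ be the piecewise linear function obtained by linear interpolation of the points P_j = ( j/m , sin(jπ/2)/m ) for j = 0, 1, …, m. Then f belongs to the Strassen class: f(0) = 0, f is absolutely continuous on [0,1], and ∫₀¹ (f'(x))² dx = 1. Moreover |f| attains the value 1/(2K−1) at exactly K points of [0,1], and f vanishes at some point strictly between any two consecutive such points. -/

import Mathlib

open MeasureTheory

lemma zz_sin_even (i : ℕ) : Real.sin (((2 * i : ℕ) : ℝ) * Real.pi / 2) = 0 := by
  rw [show ((2 * i : ℕ) : ℝ) * Real.pi / 2 = i * Real.pi by push_cast; ring]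
  exact Real.sin_nat_mul_pi i

lemma zz_sin_odd (i : ℕ) : |Real.sin (((2 * i + 1 : ℕ) : ℝ) * Real.pi / 2)| = 1 := by
  rw [show ((2 * i + 1 : ℕ) : ℝ) * Real.pi / 2 = i * Real.pi + Real.pi / 2 by push_cast; ring,
    Real.sin_add_pi_div_two, Real.cos_nat_mul_pi]
  simp

noncomputable def zzc (j : ℕ) : ℝ :=
  Real.sin (((j + 1 : ℕ) : ℝ) * Real.pi / 2) - Real.sin ((j : ℝ) * Real.pi / 2)

lemma zzc_sq (j : ℕ) : zzc j ^ 2 = 1 := by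
  unfold zzc
  rcases Nat.even_or_odd' j with ⟨i, rfl | rfl⟩
  · rw [zz_sin_even, sub_zero, ← sq_abs, zz_sin_odd]; norm_num
  · rw [show 2 * i + 1 + 1 = 2 * (i + 1) by ring, zz_sin_even, zero_sub, neg_sq, ← sq_abs,
      zz_sin_odd]; norm_num

noncomputable def zzg (M : ℝ) (x : ℝ) : ℝ := zzc ⌊M * x⌋₊

lemma zzg_int (M a b : ℝ) : IntervalIntegrable (zzg M) volume a b := by
  have hm : Measurable (zzg M) := by
    have h1 : Measurable zzc := measurable_from_top
    exact h1.comp (Nat.measurable_floor.comp (measurable_const.mul measurable_id))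
  refine (intervalIntegrable_const (c := (1 : ℝ))).mono_fun hm.aestronglyMeasurable ?_
  refine Filter.Eventually.of_forall fun x => ?_
  have := zzc_sq ⌊M * x⌋₊
  simp only [zzg, Real.norm_eq_abs, abs_one]
  exact (sq_le_one_iff_abs_le_one _).1 this.le

lemma zzg_step (M : ℝ) (hM : 0 < M) (j : ℕ) (t : ℝ) (ht : t ∈ Set.Icc (0 : ℝ) 1) :
    ∫ x in ((j : ℝ) / M)..(((j : ℝ) + t) / M), zzg M x = t * zzc j / M := by
  have hle : (j : ℝ) / M ≤ ((j : ℝ) + t) / M := by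
    gcongr; linarith [ht.1]
  have h : ∫ x in ((j : ℝ) / M)..(((j : ℝ) + t) / M), zzg M x
      = ∫ x in ((j : ℝ) / M)..(((j : ℝ) + t) / M), zzc j := by
    rw [intervalIntegral.integral_of_le hle, intervalIntegral.integral_of_le hle,
      integral_Ioc_eq_integral_Ioo, integral_Ioc_eq_integral_Ioo]
    refine setIntegral_congr_fun measurableSet_Ioo fun x hx => ?_
    have h1 := (div_lt_iff₀ hM).1 hx.1
    have h2 := (lt_div_iff₀ hM).1 hx.2
    simp only [zzg]
    congr 1
    rw [Nat.floor_eq_iff (by nlinarith [Nat.cast_nonneg (α := ℝ) j])]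
    constructor <;> nlinarith [ht.2]
  rw [h, intervalIntegral.integral_const, smul_eq_mul]
  field_simp
  ring

lemma zz_node (M : ℝ) (hM : 0 < M) (j : ℕ) :
    ∫ x in (0 : ℝ)..((j : ℝ) / M), zzg M x = Real.sin ((j : ℝ) * Real.pi / 2) / M := by
  induction j with
  | zero => simp
  | succ j ih =>
    have h := zzg_step M hM j 1 (by simp)
    have h2 := intervalIntegral.integral_add_adjacent_intervals
      (zzg_int M 0 ((j : ℝ) / M)) (zzg_int M ((j : ℝ) / M) (((j : ℝ) + 1) / M))
    rw [ih, h] at h2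
    rw [Nat.cast_succ, ← h2, zzc]
    push_cast
    ring

/-- Let `f` be the piecewise linear function on `[0,1]` interpolating the points
`P_j = (j/(2K-1), sin(jπ/2)/(2K-1))`, `j = 0, 1, …, 2K-1`. Then `f` belongs to the
Strassen class: `f 0 = 0`, `f` is absolutely continuous on `[0,1]` (i.e. it is the
integral of some integrable function `g`) with `∫₀¹ (f')² = 1`. Moreover `|f|` attains
the value `1/(2K-1)` at exactly `K` points of `[0,1]`, and `f` vanishes strictly between
any two of these points. -/
theorem zigzag_in_strassen_class
    (K : ℕ) (hK : 1 ≤ K) (f : ℝ → ℝ)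
    (hinterp : ∀ j : ℕ, (j : ℝ) ≤ 2 * K - 1 →
      f ((j : ℝ) / (2 * K - 1)) = Real.sin (j * Real.pi / 2) / (2 * K - 1))
    (hlin : ∀ j : ℕ, (j : ℝ) < 2 * K - 1 → ∀ t ∈ Set.Icc (0 : ℝ) 1,
      f (((j : ℝ) + t) / (2 * K - 1))
        = (1 - t) * f ((j : ℝ) / (2 * K - 1)) + t * f (((j : ℝ) + 1) / (2 * K - 1))) :
    f 0 = 0 ∧
    (∃ g : ℝ → ℝ, IntervalIntegrable g volume 0 1 ∧
      (∀ x ∈ Set.Icc (0 : ℝ) 1, f x = ∫ t in (0 : ℝ)..x, g t) ∧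
      (∫ t in (0 : ℝ)..1, (g t) ^ 2) = 1) ∧
    (∃ s : Finset ℝ, s.card = K ∧ (↑s : Set ℝ) ⊆ Set.Icc (0 : ℝ) 1 ∧
      (∀ x ∈ Set.Icc (0 : ℝ) 1, (|f x| = 1 / (2 * K - 1) ↔ x ∈ s)) ∧
      ∀ x ∈ s, ∀ y ∈ s, x < y → ∃ z ∈ Set.Ioo x y, f z = 0) := by
  obtain ⟨k, rfl⟩ : ∃ k, K = k + 1 := ⟨K - 1, by omega⟩
  have hMk : (2 * ((k + 1 : ℕ) : ℝ) - 1) = ((2 * k + 1 : ℕ) : ℝ) := by push_cast; ring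
  rw [hMk] at hinterp hlin ⊢
  obtain ⟨M, hMd⟩ : ∃ M : ℝ, M = ((2 * k + 1 : ℕ) : ℝ) := ⟨_, rfl⟩
  have hM : 0 < M := by rw [hMd]; positivity
  have hcast : ∀ j : ℕ, (j : ℝ) ≤ M ↔ j ≤ 2 * k + 1 := fun j => by rw [hMd]; exact Nat.cast_le
  have hcast' : ∀ j : ℕ, (j : ℝ) < M ↔ j < 2 * k + 1 := fun j => by rw [hMd]; exact Nat.cast_lt
  rw [← hMd] at hinterp hlin ⊢
  -- explicit form
  have hf : ∀ j : ℕ, j < 2 * k + 1 → ∀ t ∈ Set.Icc (0 : ℝ) 1, f (((j : ℝ) + t) / M)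
      = ((1 - t) * Real.sin ((j : ℝ) * Real.pi / 2)
        + t * Real.sin (((j + 1 : ℕ) : ℝ) * Real.pi / 2)) / M := by
    intro j hj t ht
    have h1 := hinterp (j + 1) ((hcast _).2 hj)
    have h0 := hinterp j ((hcast _).2 hj.le)
    rw [hlin j ((hcast' _).2 hj) t ht, h0, ← Nat.cast_succ, h1]
    ring
  -- decomposition
  have hdec : ∀ x ∈ Set.Icc (0 : ℝ) 1, x = 1 ∨ ∃ j : ℕ, j < 2 * k + 1 ∧ ∃ t : ℝ, 0 ≤ t ∧ t < 1 ∧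
      x = ((j : ℝ) + t) / M := by
    intro x hx
    rcases hx.2.eq_or_lt with h | h
    · exact Or.inl h
    · right
      have hMx : 0 ≤ M * x := mul_nonneg hM.le hx.1
      have h1 := Nat.floor_le hMx
      have h2 := Nat.lt_floor_add_one (M * x)
      refine ⟨⌊M * x⌋₊, (hcast' _).1 (by nlinarith), M * x - ⌊M * x⌋₊, by linarith, by linarith, ?_⟩
      field_simp
      ring
  have hf1 : f 1 = Real.sin (((2 * k + 1 : ℕ) : ℝ) * Real.pi / 2) / M := by
    have h := hinterp (2 * k + 1) ((hcast _).2 le_rfl)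
    rw [← hMd, div_self hM.ne'] at h
    rw [h, ← hMd]
  refine ⟨?_, ⟨zzg M, zzg_int M 0 1, ?_, ?_⟩, ?_⟩
  · simpa using hinterp 0 (by simpa using hM.le)
  · intro x hx
    rcases hdec x hx with rfl | ⟨j, hj, t, ht0, ht1, rfl⟩
    · have h := zz_node M hM (2 * k + 1)
      rw [← hMd, div_self hM.ne', hMd] at h
      rw [hf1, hMd, h]
    · rw [hf j hj t ⟨ht0, ht1.le⟩, ← intervalIntegral.integral_add_adjacent_intervals
        (zzg_int M 0 ((j : ℝ) / M)) (zzg_int M ((j : ℝ) / M) (((j : ℝ) + t) / M)),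
        zz_node M hM, zzg_step M hM j t ⟨ht0, ht1.le⟩, zzc]
      ring
  · simp [zzg, zzc_sq]
  · have hinj : Function.Injective (fun i : ℕ => ((2 * i + 1 : ℕ) : ℝ) / M) := by
      intro a b hab
      have h := (div_left_inj' hM.ne').1 hab
      have h' : 2 * a + 1 = 2 * b + 1 := by exact_mod_cast h
      omega
    refine ⟨(Finset.range (k + 1)).image (fun i : ℕ => ((2 * i + 1 : ℕ) : ℝ) / M), ?_, ?_, ?_, ?_⟩
    · rw [Finset.card_image_of_injective _ hinj, Finset.card_range]
    · intro x hx
      simp only [Finset.coe_image, Set.mem_image, Finset.mem_coe, Finset.mem_range] at hx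
      obtain ⟨i, hi, rfl⟩ := hx
      exact ⟨by positivity, (div_le_one hM).2 ((hcast _).2 (by omega))⟩
    · intro x hx
      simp only [Finset.mem_image, Finset.mem_range]
      constructor
      · intro h
        rcases hdec x hx with rfl | ⟨j, hj, t, ht0, ht1, rfl⟩
        · exact ⟨k, by omega, by rw [← hMd, div_self hM.ne']⟩
        · rw [hf j hj t ⟨ht0, ht1.le⟩, abs_div, abs_of_pos hM, div_left_inj' hM.ne'] at h
          rcases Nat.even_or_odd' j with ⟨i, rfl | rfl⟩
          · rw [zz_sin_even, mul_zero, zero_add, abs_mul, zz_sin_odd, abs_of_nonneg ht0] at h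
            linarith
          · rw [show 2 * i + 1 + 1 = 2 * (i + 1) by ring, zz_sin_even, mul_zero, add_zero,
              abs_mul, zz_sin_odd, abs_of_nonneg (by linarith)] at h
            have : t = 0 := by linarith
            exact ⟨i, by omega, by rw [this, add_zero]⟩
      · rintro ⟨i, hi, rfl⟩
        rw [hinterp _ ((hcast _).2 (by omega)), abs_div, zz_sin_odd, abs_of_pos hM]
    · intro x hx y hy hxy
      simp only [Finset.mem_image, Finset.mem_range] at hx hy
      obtain ⟨a, ha, rfl⟩ := hx
      obtain ⟨b, hb, rfl⟩ := hy
      have hab : 2 * a + 1 < 2 * b + 1 := by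
        have := (div_lt_div_iff_of_pos_right hM).1 hxy
        exact_mod_cast this
      refine ⟨((2 * (a + 1) : ℕ) : ℝ) / M, ⟨?_, ?_⟩, ?_⟩
      · refine (div_lt_div_iff_of_pos_right hM).2 ?_
        exact_mod_cast (by omega : 2 * a + 1 < 2 * (a + 1))
      · refine (div_lt_div_iff_of_pos_right hM).2 ?_
        exact_mod_cast (by omega : 2 * (a + 1) < 2 * b + 1)
      · rw [hinterp _ ((hcast _).2 (by omega)), zz_sin_even, zero_div]
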